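/- Fix α ∈ (0,1) and let 0 < s < u < 1 be such that f_t'(x) > 1 for every t ∈ [s,u] and every x ∈ S¹ with dist(x,0) ≥ p_u. Then for every Borel probability measure θ on [s,u], for θ^ℕ × m-almost every pair (ω, x) ∈ [s,u]^ℕ × S¹, the empirical measures (1/N) Σ_{j=0}^{N−1} δ_{f_ω^j(x)} converge to δ_0 in the weak* topology as N → ∞, where θ^ℕ denotes the countable product measure on [s,u]^ℕ. -/

import Mathlib

open MeasureTheory Set Filter Topology

noncomputable section

/-- The circle `S¹ = ℝ/ℤ`. -/
abbrev Circle1 : Type := AddCircle (1 : ℝ)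

/-- Lift `F_t` of the map `f_t`: it satisfies `F_t(x+1) = F_t(x) + 2`,
`F_t(x) = t x + 2^α (2-t) x^(1+α)` for `x ∈ [0,1/2)` and
`F_t(x) = 2 - t(1-x) - 2^α (2-t) (1-x)^(1+α)` for `x ∈ [1/2,1)`. -/
noncomputable def Flift (α t x : ℝ) : ℝ :=
  2 * (⌊x⌋ : ℝ) +
    (if Int.fract x < 1 / 2
      then t * Int.fract x + 2 ^ α * (2 - t) * Int.fract x ^ (1 + α)
      else 2 - t * (1 - Int.fract x) - 2 ^ α * (2 - t) * (1 - Int.fract x) ^ (1 + α))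

/-- The circle map `f_t` induced by the lift `F_t`. -/
noncomputable def fmap (α t : ℝ) : Circle1 → Circle1 :=
  AddCircle.liftIco 1 0 (fun x => ((Flift α t x : ℝ) : Circle1))

/-- The fixed point `p_s = (1/2)·((1−s)/(2−s))^(1/α)` of `f_s`. -/
noncomputable def pfix (α s : ℝ) : ℝ := (1 / 2) * ((1 - s) / (2 - s)) ^ (1 / α)

/-- Random iteration: `fIter α ω 0 = id` and
`fIter α ω (n+1) = f_{ω n} ∘ fIter α ω n`. -/
noncomputable def fIter (α : ℝ) (ω : ℕ → ℝ) : ℕ → Circle1 → Circle1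
  | 0 => id
  | n + 1 => fmap α (ω n) ∘ fIter α ω n

/-- The (closed) support of a measure on a topological space. -/
def mSupport {Y : Type*} [TopologicalSpace Y] [MeasurableSpace Y] (θ : Measure Y) : Set Y :=
  {t | ∀ U ∈ 𝓝 t, θ U ≠ 0}

/-- `μ` is a stationary measure for the random system given by the family `g`
of maps of the circle and the noise distribution `θ`. -/
def IsStationaryC (g : ℝ → Circle1 → Circle1) (θ : Measure ℝ) (μ : Measure Circle1) : Prop :=
  ∀ φ : C(Circle1, ℝ), ∫ x, ∫ t, φ (g t x) ∂θ ∂μ = ∫ x, φ x ∂μ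

/-- `P` is the countable product `θ^ℕ` of copies of the probability measure `θ`. -/
def IsProductOf {Y : Type*} [MeasurableSpace Y] (θ : Measure Y) (P : Measure (ℕ → Y)) : Prop :=
  IsProbabilityMeasure P ∧ ∀ (k : ℕ) (A : ℕ → Set Y), (∀ i, MeasurableSet (A i)) →
    P {ω | ∀ i < k, ω i ∈ A i} = ∏ i ∈ Finset.range k, θ (A i)



/-- The increasing branch of the lift of `f_t` on `[0, 1/2]`. -/
def branch (α t x : ℝ) : ℝ := t * x + 2 ^ α * (2 - t) * x ^ (1 + α)

/-- The derivative of `branch α t`. -/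
def branchDeriv (α t x : ℝ) : ℝ := t + 2 ^ α * (2 - t) * ((1 + α) * x ^ α)

/-- The inverse of `branch α t : [0, 1/2] → [0, 1]`. -/
def branchInv (α t : ℝ) : ℝ → ℝ := Function.invFunOn (branch α t) (Icc 0 (1 / 2))

/-- The quotient of `f_t` by the reflection `x ↦ -x`, acting on `[0, 1/2]`. -/
def foldMap (α t x : ℝ) : ℝ := min (branch α t x) (1 - branch α t x)

/-- Random iteration of the folded maps. -/
def foldIter (α : ℝ) (ω : ℕ → ℝ) : ℕ → ℝ → ℝ
  | 0 => id
  | n + 1 => foldMap α (ω n) ∘ foldIter α ω n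

/-- The contribution of the increasing branch to the transfer operator. -/
def branchTransfer (α t : ℝ) (h : ℝ → ℝ) (y : ℝ) : ℝ :=
  h (branchInv α t y) * (branchDeriv α t (branchInv α t y))⁻¹

/-- The transfer operator of the folded map. -/
def transfer (α t : ℝ) (h : ℝ → ℝ) (y : ℝ) : ℝ :=
  branchTransfer α t h y + branchTransfer α t h (1 - y)

/-- Density of the law of the folded orbit, restricted to survival outside the basin. -/
def survivalDensity (α : ℝ) (ω : ℕ → ℝ) : ℕ → ℝ → ℝ
  | 0 => fun _ => 1
  | n + 1 => transfer α (ω n) (survivalDensity α ω n)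

section Branch

variable {α t x y : ℝ}

lemma branch_eq (hα : 0 < α) (hx : 0 ≤ x) :
    branch α t x = x * (t + (2 - t) * (2 * x) ^ α) := by
  unfold branch
  rw [Real.mul_rpow (by norm_num) hx, Real.rpow_add_of_nonneg hx (by norm_num) hα.le,
    Real.rpow_one]
  ring

lemma branchDeriv_eq (hx : 0 ≤ x) :
    branchDeriv α t x = t + (1 + α) * (2 - t) * (2 * x) ^ α := by
  unfold branchDeriv
  rw [Real.mul_rpow (by norm_num) hx]
  ring

lemma branch_zero (hα : 0 < α) : branch α t 0 = 0 := by
  rw [branch_eq hα le_rfl, zero_mul]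

lemma branch_half (hα : 0 < α) : branch α t (1 / 2) = 1 := by
  rw [branch_eq hα (by norm_num)]
  norm_num

lemma hasDerivAt_branch (hα : 0 < α) (x : ℝ) :
    HasDerivAt (branch α t) (branchDeriv α t x) x := by
  have h := ((hasDerivAt_id x).const_mul t).add
    ((Real.hasDerivAt_rpow_const (x := x) (p := 1 + α) (Or.inr (by linarith))).const_mul
      (2 ^ α * (2 - t)))
  refine h.congr_deriv ?_
  rw [branchDeriv, show 1 + α - 1 = α by ring]
  ring

lemma branchDeriv_pos (hα : 0 < α) (ht : 0 < t) (ht1 : t < 1) (hx : 0 ≤ x) :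
    0 < branchDeriv α t x := by
  rw [branchDeriv_eq hx]
  have h2 : 0 < 2 - t := by linarith
  positivity

lemma branchDeriv_mono (hα : 0 < α) (ht1 : t < 1) (hx : 0 ≤ x) (hxy : x ≤ y) :
    branchDeriv α t x ≤ branchDeriv α t y := by
  rw [branchDeriv_eq hx, branchDeriv_eq (hx.trans hxy)]
  have h2 : 0 < 2 - t := by linarith
  gcongr

lemma branch_strictMonoOn (hα : 0 < α) (ht : 0 < t) (ht1 : t < 1) :
    StrictMonoOn (branch α t) (Ici 0) := by
  intro x hx y hy hxy
  have hx : 0 ≤ x := hx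
  have hy : 0 ≤ y := hy
  rw [branch_eq hα hx, branch_eq hα hy]
  have h2 : 0 < 2 - t := by linarith
  have : t + (2 - t) * (2 * x) ^ α ≤ t + (2 - t) * (2 * y) ^ α := by gcongr
  have hpos : 0 < t + (2 - t) * (2 * x) ^ α := by positivity
  nlinarith

lemma branch_mem_Icc (hα : 0 < α) (ht : 0 < t) (ht1 : t < 1) (hx : x ∈ Icc (0 : ℝ) (1 / 2)) :
    branch α t x ∈ Icc (0 : ℝ) 1 := by
  have hm := (branch_strictMonoOn hα ht ht1).monotoneOn
  constructor
  · simpa [branch_zero hα] using hm (mem_Ici.2 le_rfl) (mem_Ici.2 hx.1) hx.1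
  · have := hm (mem_Ici.2 hx.1) (mem_Ici.2 (by norm_num : (0 : ℝ) ≤ 1 / 2)) hx.2
    rwa [branch_half hα] at this

lemma foldMap_mem_Icc (hα : 0 < α) (ht : 0 < t) (ht1 : t < 1) (hx : x ∈ Icc (0 : ℝ) (1 / 2)) :
    foldMap α t x ∈ Icc (0 : ℝ) (1 / 2) := by
  have h := branch_mem_Icc hα ht ht1 hx
  refine ⟨le_min h.1 (by linarith [h.2]), ?_⟩
  unfold foldMap
  rcases le_total (branch α t x) (1 / 2) with h' | h'
  · exact (min_le_left _ _).trans h'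
  · exact (min_le_right _ _).trans (by linarith)

lemma branchInv_spec (hα : 0 < α) (hy : y ∈ Icc (0 : ℝ) 1) :
    branchInv α t y ∈ Icc (0 : ℝ) (1 / 2) ∧ branch α t (branchInv α t y) = y := by
  have hc : ContinuousOn (branch α t) (Icc 0 (1 / 2)) := fun x _ =>
    (hasDerivAt_branch hα x).continuousAt.continuousWithinAt
  have := intermediate_value_Icc (by norm_num : (0 : ℝ) ≤ 1 / 2) hc
  rw [branch_zero hα, branch_half hα] at this
  have hy' : ∃ x ∈ Icc (0 : ℝ) (1 / 2), branch α t x = y := this hy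
  exact ⟨Function.invFunOn_mem hy', Function.invFunOn_eq hy'⟩

lemma branchInv_branch (hα : 0 < α) (ht : 0 < t) (ht1 : t < 1) (hx : x ∈ Icc (0 : ℝ) (1 / 2)) :
    branchInv α t (branch α t x) = x := by
  have h := branchInv_spec (t := t) hα (branch_mem_Icc hα ht ht1 hx)
  exact (branch_strictMonoOn hα ht ht1).injOn h.1.1 hx.1 h.2

lemma branchInv_le_branchInv (hα : 0 < α) (ht : 0 < t) (ht1 : t < 1) (hx : x ∈ Icc (0 : ℝ) 1)
    (hy : y ∈ Icc (0 : ℝ) 1) (hxy : x ≤ y) : branchInv α t x ≤ branchInv α t y := by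
  have h1 := branchInv_spec (t := t) hα hx
  have h2 := branchInv_spec (t := t) hα hy
  rw [← (branch_strictMonoOn hα ht ht1).le_iff_le h1.1.1 h2.1.1, h1.2, h2.2]
  exact hxy

lemma convexOn_branch (hα : 0 < α) (ht1 : t < 1) : ConvexOn ℝ (Ici 0) (branch α t) := by
  have h1 : ConvexOn ℝ (Ici (0 : ℝ)) fun x => t * x :=
    ((LinearMap.mul ℝ ℝ t).convexOn (convex_Ici 0))
  have h2 := (convexOn_rpow (p := 1 + α) (by linarith)).smul
    (c := 2 ^ α * (2 - t)) (by have : 0 < 2 - t := by linarith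
                               positivity)
  exact h1.add h2

lemma concaveOn_branchInv (hα : 0 < α) (ht : 0 < t) (ht1 : t < 1) :
    ConcaveOn ℝ (Icc 0 1) (branchInv α t) := by
  refine ⟨convex_Icc 0 1, fun x hx y hy a b ha hb hab => ?_⟩
  have hz := convex_Icc (0 : ℝ) 1 hx hy ha hb hab
  have h1 := branchInv_spec (t := t) hα hx
  have h2 := branchInv_spec (t := t) hα hy
  have h3 := branchInv_spec (t := t) hα hz
  have hm := convex_Ici (0 : ℝ) h1.1.1 h2.1.1 ha hb hab
  rw [← (branch_strictMonoOn hα ht ht1).le_iff_le hm h3.1.1, h3.2]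
  have := (convexOn_branch hα ht1).2 h1.1.1 h2.1.1 ha hb hab
  rwa [h1.2, h2.2] at this

lemma concaveOn_branchDeriv (hα : 0 < α) (hα1 : α < 1) (ht1 : t < 1) :
    ConcaveOn ℝ (Ici 0) (branchDeriv α t) := by
  have h2 := (Real.concaveOn_rpow hα.le hα1.le).smul
    (c := 2 ^ α * (2 - t) * (1 + α)) (by have : 0 < 2 - t := by linarith
                                         positivity)
  refine ((concaveOn_const t (convex_Ici 0)).add h2).congr fun x _ => ?_
  simp [branchDeriv]
  ring

lemma convexOn_inv_branchDeriv (hα : 0 < α) (hα1 : α < 1) (ht : 0 < t) (ht1 : t < 1) :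
    ConvexOn ℝ (Ici 0) fun x => (branchDeriv α t x)⁻¹ := by
  refine ⟨convex_Ici 0, fun x hx y hy a b ha hb hab => ?_⟩
  have hdx := branchDeriv_pos (x := x) hα ht ht1 hx
  have hdy := branchDeriv_pos (x := y) hα ht ht1 hy
  have h1 := (concaveOn_branchDeriv hα hα1 ht1).2 hx hy ha hb hab
  have h2 := (convexOn_zpow (𝕜 := ℝ) (-1)).2 hdx hdy ha hb hab
  simp only [zpow_neg_one, smul_eq_mul] at h1 h2 ⊢
  refine le_trans ?_ h2
  have : 0 < a * branchDeriv α t x + b * branchDeriv α t y :=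
    convex_Ioi (0 : ℝ) hdx hdy ha hb hab
  gcongr

end Branch

/-- The cone of nonnegative, decreasing, convex densities on `[p, 1/2]`. -/
structure IsConeDensity (p : ℝ) (h : ℝ → ℝ) : Prop where
  nonneg : ∀ x ∈ Icc p (1 / 2), 0 ≤ h x
  antitone : AntitoneOn h (Icc p (1 / 2))
  convex : ConvexOn ℝ (Icc p (1 / 2)) h

section Cone

variable {α t p lam : ℝ} {h : ℝ → ℝ}

lemma branchInv_mem (hα : 0 < α) (ht : 0 < t) (ht1 : t < 1) (hp : 0 < p)
    (hfix : branch α t p ≤ p) {y : ℝ} (hy : y ∈ Icc p 1) :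
    branchInv α t y ∈ Icc p (1 / 2) := by
  have hy' : y ∈ Icc (0 : ℝ) 1 := ⟨hp.le.trans hy.1, hy.2⟩
  have hs := branchInv_spec (t := t) hα hy'
  refine ⟨?_, hs.1.2⟩
  rw [← (branch_strictMonoOn hα ht ht1).le_iff_le (mem_Ici.2 hp.le) hs.1.1, hs.2]
  exact hfix.trans hy.1

lemma IsConeDensity.branchTransfer_nonneg (hc : IsConeDensity p h) (hα : 0 < α) (ht : 0 < t)
    (ht1 : t < 1) (hp : 0 < p) (hfix : branch α t p ≤ p) {y : ℝ}
    (hy : y ∈ Icc p 1) : 0 ≤ branchTransfer α t h y := by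
  have hm := branchInv_mem hα ht ht1 hp hfix hy
  exact mul_nonneg (hc.nonneg _ hm)
    (inv_nonneg.2 (branchDeriv_pos hα ht ht1 (hp.le.trans hm.1)).le)

lemma antitoneOn_inv_branchDeriv (hα : 0 < α) (ht : 0 < t) (ht1 : t < 1) :
    AntitoneOn (fun x => (branchDeriv α t x)⁻¹) (Ici 0) := fun _ hx _ _ hxy =>
  inv_anti₀ (branchDeriv_pos hα ht ht1 hx) (branchDeriv_mono hα ht1 hx hxy)

lemma IsConeDensity.mul_inv (hc : IsConeDensity p h) (hα : 0 < α) (hα1 : α < 1) (ht : 0 < t)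
    (ht1 : t < 1) (hp : 0 < p) : IsConeDensity p (h * fun x => (branchDeriv α t x)⁻¹) := by
  have hsub : Icc p (1 / 2) ⊆ Ici 0 := fun x hx => hp.le.trans hx.1
  have hpos : ∀ x ∈ Icc p (1 / 2), 0 ≤ (branchDeriv α t x)⁻¹ := fun x hx =>
    inv_nonneg.2 (branchDeriv_pos hα ht ht1 (hsub hx)).le
  have hanti := (antitoneOn_inv_branchDeriv (α := α) hα ht ht1).mono hsub
  refine ⟨fun x hx => mul_nonneg (hc.nonneg x hx) (hpos x hx), fun x hx y hy hxy =>
    mul_le_mul (hc.antitone hx hy hxy) (hanti hx hy hxy) (hpos y hy) (hc.nonneg x hx), ?_⟩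
  exact hc.convex.mul ((convexOn_inv_branchDeriv hα hα1 ht ht1).subset hsub (convex_Icc _ _))
    hc.nonneg hpos (hc.antitone.monovaryOn hanti)

lemma IsConeDensity.branchTransfer_antitone (hc : IsConeDensity p h) (hα : 0 < α) (hα1 : α < 1)
    (ht : 0 < t) (ht1 : t < 1) (hp : 0 < p) (hfix : branch α t p ≤ p) :
    AntitoneOn (branchTransfer α t h) (Icc p 1) := fun _ hx _ hy hxy =>
  (hc.mul_inv hα hα1 ht ht1 hp).antitone (branchInv_mem hα ht ht1 hp hfix hx)
    (branchInv_mem hα ht ht1 hp hfix hy)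
    (branchInv_le_branchInv hα ht ht1 ⟨hp.le.trans hx.1, hx.2⟩ ⟨hp.le.trans hy.1, hy.2⟩ hxy)

lemma IsConeDensity.branchTransfer_convex (hc : IsConeDensity p h) (hα : 0 < α) (hα1 : α < 1)
    (ht : 0 < t) (ht1 : t < 1) (hp : 0 < p) (hfix : branch α t p ≤ p) :
    ConvexOn ℝ (Icc p 1) (branchTransfer α t h) := by
  refine ⟨convex_Icc _ _, fun x hx y hy a b ha hb hab => ?_⟩
  have hk := hc.mul_inv hα hα1 ht ht1 hp
  have hx' := branchInv_mem hα ht ht1 hp hfix hx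
  have hy' := branchInv_mem hα ht ht1 hp hfix hy
  have hz := branchInv_mem hα ht ht1 hp hfix (convex_Icc _ _ hx hy ha hb hab)
  refine (hk.antitone (convex_Icc _ _ hx' hy' ha hb hab) hz ?_).trans
    (hk.convex.2 hx' hy' ha hb hab)
  exact (concaveOn_branchInv hα ht ht1).2 ⟨hp.le.trans hx.1, hx.2⟩ ⟨hp.le.trans hy.1, hy.2⟩
    ha hb hab

/-- Symmetrising a convex function about `1/2` gives a decreasing function on the left half. -/
lemma ConvexOn.antitoneOn_add_reflect {H : ℝ → ℝ} (hH : ConvexOn ℝ (Icc p (1 - p)) H) :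
    AntitoneOn (fun y => H y + H (1 - y)) (Icc p (1 / 2)) := by
  intro x hx y hy hxy
  rcases hxy.eq_or_lt with rfl | hlt
  · exact le_rfl
  have hx1 : x ∈ Icc p (1 - p) := ⟨hx.1, by linarith [hx.1, hx.2]⟩
  have hx2 : 1 - x ∈ Icc p (1 - p) := ⟨by linarith [hx.1, hx.2], by linarith [hx.1]⟩
  have hd : 0 < 1 - 2 * x := by linarith [hy.2]
  set b := (y - x) / (1 - 2 * x) with hb
  have hb0 : 0 ≤ b := div_nonneg (by linarith) hd.le
  have hb1 : b ≤ 1 := (div_le_one hd).2 (by linarith [hy.2])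
  have hbd : b * (1 - 2 * x) = y - x := div_mul_cancel₀ _ hd.ne'
  have e1 := hH.2 hx1 hx2 (sub_nonneg.2 hb1) hb0 (by ring)
  have e2 := hH.2 hx1 hx2 hb0 (sub_nonneg.2 hb1) (by ring)
  simp only [smul_eq_mul] at e1 e2
  rw [show (1 - b) * x + b * (1 - x) = y by linarith] at e1
  rw [show b * x + (1 - b) * (1 - x) = 1 - y by linarith] at e2
  change H y + H (1 - y) ≤ H x + H (1 - x)
  linarith

lemma IsConeDensity.transfer (hc : IsConeDensity p h) (hα : 0 < α) (hα1 : α < 1)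
    (ht : 0 < t) (ht1 : t < 1) (hp : 0 < p) (hp2 : p < 1 / 2) (hfix : branch α t p ≤ p) :
    IsConeDensity p (transfer α t h) := by
  have hconv := hc.branchTransfer_convex hα hα1 ht ht1 hp hfix
  refine ⟨fun x hx => ?_, ?_, ?_⟩
  · exact add_nonneg
      (hc.branchTransfer_nonneg hα ht ht1 hp hfix ⟨hx.1, by linarith [hx.2]⟩)
      (hc.branchTransfer_nonneg hα ht ht1 hp hfix
        ⟨by linarith [hx.1, hx.2], by linarith [hx.1]⟩)
  · exact ConvexOn.antitoneOn_add_reflect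
      (hconv.subset (Icc_subset_Icc le_rfl (by linarith)) (convex_Icc _ _))
  · refine ConvexOn.add (hconv.subset (Icc_subset_Icc le_rfl (by linarith)) (convex_Icc _ _)) ?_
    refine ⟨convex_Icc _ _, fun x hx y hy a b ha hb hab => ?_⟩
    have hx2 : 1 - x ∈ Icc p 1 := ⟨by linarith [hx.1, hx.2], by linarith [hx.1]⟩
    have hy2 : 1 - y ∈ Icc p 1 := ⟨by linarith [hy.1, hy.2], by linarith [hy.1]⟩
    have := hconv.2 hx2 hy2 ha hb hab
    simp only [smul_eq_mul] at this ⊢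
    rwa [show a * (1 - x) + b * (1 - y) = 1 - (a * x + b * y) by linear_combination hab] at this

lemma IsConeDensity.transfer_left_le (hc : IsConeDensity p h) (hα : 0 < α) (hα1 : α < 1)
    (ht : 0 < t) (ht1 : t < 1) (hp : 0 < p) (hp2 : p < 1 / 2) (hfix : branch α t p ≤ p)
    (hlam : 0 < lam) (hexp : lam ≤ branchDeriv α t p) :
    _root_.transfer α t h p ≤ h p * lam⁻¹ + _root_.transfer α t h (1 / 2) := by
  have hanti := hc.branchTransfer_antitone hα hα1 ht ht1 hp hfix
  have hhalf : (1 / 2 : ℝ) ∈ Icc p 1 := ⟨hp2.le, by norm_num⟩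
  have h1 : branchTransfer α t h (1 - p) ≤ branchTransfer α t h (1 / 2) :=
    hanti hhalf ⟨by linarith, by linarith⟩ (by linarith)
  have h0 := hc.branchTransfer_nonneg hα ht ht1 hp hfix hhalf
  have hm := branchInv_mem hα ht ht1 hp hfix (y := p) ⟨le_rfl, by linarith⟩
  have h2 : branchTransfer α t h p ≤ h p * lam⁻¹ := by
    refine mul_le_mul (hc.antitone ⟨le_rfl, hp2.le⟩ hm hm.1) ?_ ?_
      (hc.nonneg _ ⟨le_rfl, hp2.le⟩)
    · exact inv_anti₀ hlam (hexp.trans (branchDeriv_mono hα ht1 hp.le hm.1))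
    · exact inv_nonneg.2 (branchDeriv_pos hα ht ht1 (hp.le.trans hm.1)).le
  have e : _root_.transfer α t h (1 / 2) =
      branchTransfer α t h (1 / 2) + branchTransfer α t h (1 / 2) := by
    unfold _root_.transfer; norm_num
  rw [e]
  unfold _root_.transfer
  linarith

end Cone

section Measure

variable {α t p : ℝ} {h : ℝ → ℝ} {Q : Set ℝ}

lemma continuous_branch (hα : 0 < α) : Continuous (branch α t) :=
  continuous_iff_continuousAt.2 fun x => (hasDerivAt_branch hα x).continuousAt

lemma continuous_foldMap (hα : 0 < α) : Continuous (foldMap α t) :=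
  (continuous_branch hα).min (continuous_const.sub (continuous_branch hα))

lemma Icc_inter_foldMap_preimage (hQ : Q ⊆ Icc p (1 / 2)) :
    Icc p (1 / 2) ∩ foldMap α t ⁻¹' Q =
      (Icc p (1 / 2) ∩ branch α t ⁻¹' Q) ∪ (Icc p (1 / 2) ∩ (fun x => 1 - branch α t x) ⁻¹' Q) := by
  rw [← inter_union_distrib_left]
  congr 1
  ext x
  simp only [mem_preimage, mem_union]
  constructor
  · intro hx
    rcases min_choice (branch α t x) (1 - branch α t x) with h' | h'
    · left; rwa [foldMap, h'] at hx
    · right; rwa [foldMap, h'] at hx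
  · rintro (hx | hx)
    · rwa [foldMap, min_eq_left (by linarith [(hQ hx).2])]
    · rwa [foldMap, min_eq_right (by linarith [(hQ hx).2])]

/-- Change of variables along a monotone or reflected branch. -/
lemma lintegral_Icc_inter_preimage (hα : 0 < α) (ht : 0 < t) (ht1 : t < 1) (hp : 0 < p)
    (hfix : branch α t p ≤ p) (hQ : MeasurableSet Q) (σ : ℝ → ℝ) (d : ℝ) (hd : |d| = 1)
    (hσ : ∀ x, HasDerivAt σ d x) (hσσ : ∀ x, σ (σ x) = x) (hσp : ∀ x ∈ Q, σ x ∈ Icc p 1) :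
    ∫⁻ x in Icc p (1 / 2) ∩ (fun x => σ (branch α t x)) ⁻¹' Q, ENNReal.ofReal (h x) =
      ∫⁻ y in Q, ENNReal.ofReal (branchTransfer α t h (σ y)) := by
  set S := Icc p (1 / 2) ∩ (fun x => σ (branch α t x)) ⁻¹' Q with hS
  have hS0 : ∀ x ∈ S, x ∈ Icc (0 : ℝ) (1 / 2) := fun x hx => ⟨hp.le.trans hx.1.1, hx.1.2⟩
  have hσc : Continuous σ := continuous_iff_continuousAt.2 fun x => (hσ x).continuousAt
  have himg : (fun x => σ (branch α t x)) '' S = Q := by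
    ext y
    constructor
    · rintro ⟨x, hx, rfl⟩
      exact hx.2
    · intro hy
      have h1 := hσp y hy
      have h2 := branchInv_spec (t := t) hα (y := σ y) ⟨hp.le.trans h1.1, h1.2⟩
      have h3 := branchInv_mem hα ht ht1 hp hfix h1
      have h4 : σ (branch α t (branchInv α t (σ y))) = y := by rw [h2.2, hσσ]
      exact ⟨branchInv α t (σ y), ⟨h3, by simpa only [mem_preimage, h4] using hy⟩, h4⟩
  have hSm : MeasurableSet S :=
    measurableSet_Icc.inter ((hσc.comp (continuous_branch hα)).measurable hQ)
  have hinj : InjOn (fun x => σ (branch α t x)) S := by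
    intro x hx y hy hxy
    have : branch α t x = branch α t y := by
      rw [← hσσ (branch α t x), ← hσσ (branch α t y)]
      exact congrArg σ hxy
    exact (branch_strictMonoOn hα ht ht1).injOn (hS0 x hx).1 (hS0 y hy).1 this
  have key := lintegral_image_eq_lintegral_abs_deriv_mul hSm
    (fun x _ => ((hσ _).comp x (hasDerivAt_branch (t := t) hα x)).hasDerivWithinAt) hinj
    (fun y => ENNReal.ofReal (branchTransfer α t h (σ y)))
  rw [show (σ ∘ branch α t) '' S = Q from himg] at key
  rw [key]
  refine setLIntegral_congr_fun hSm fun x hx => ?_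
  have hpos := branchDeriv_pos (x := x) hα ht ht1 (hS0 x hx).1
  simp only [Function.comp, hσσ]
  rw [branchTransfer, branchInv_branch hα ht ht1 (hS0 x hx), abs_mul, hd, one_mul,
    abs_of_pos hpos, ← ENNReal.ofReal_mul hpos.le]
  congr 1
  field_simp

lemma lintegral_foldMap_preimage (hα : 0 < α) (hα1 : α < 1) (ht : 0 < t) (ht1 : t < 1)
    (hp : 0 < p) (hp2 : p < 1 / 2) (hfix : branch α t p ≤ p) (hc : IsConeDensity p h)
    (hQ : MeasurableSet Q) (hQs : Q ⊆ Icc p (1 / 2)) :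
    ∫⁻ x in Icc p (1 / 2) ∩ foldMap α t ⁻¹' Q, ENNReal.ofReal (h x) =
      ∫⁻ y in Q, ENNReal.ofReal (transfer α t h y) := by
  have hm1 : ∀ y ∈ Q, y ∈ Icc p 1 := fun y hy => ⟨(hQs hy).1, by linarith [(hQs hy).2]⟩
  have hm2 : ∀ y ∈ Q, 1 - y ∈ Icc p 1 := fun y hy =>
    ⟨by linarith [(hQs hy).2], by linarith [(hQs hy).1]⟩
  rw [Icc_inter_foldMap_preimage hQs, Measure.restrict_union₀, lintegral_add_measure]
  · rw [lintegral_Icc_inter_preimage hα ht ht1 hp hfix hQ (fun x => x) 1 (by simp)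
        (fun x => hasDerivAt_id x) (fun _ => rfl) hm1,
      lintegral_Icc_inter_preimage hα ht ht1 hp hfix hQ (fun x => 1 - x) (-1)
        (by simp) (fun x => (hasDerivAt_id x).const_sub 1) (fun _ => by ring) hm2,
      ← lintegral_add_left']
    · refine setLIntegral_congr_fun hQ fun y hy => ?_
      exact (ENNReal.ofReal_add (hc.branchTransfer_nonneg hα ht ht1 hp hfix (hm1 y hy))
        (hc.branchTransfer_nonneg hα ht ht1 hp hfix (hm2 y hy))).symm
    · exact (aemeasurable_restrict_of_antitoneOn hQ
        ((hc.branchTransfer_antitone hα hα1 ht ht1 hp hfix).mono hm1)).ennreal_ofReal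
  · refine measure_mono_null (t := {branchInv α t (1 / 2)}) ?_ (by simp)
    rintro x ⟨hx1, hx2⟩
    have e1 := (hQs hx1.2).2
    have e2 := (hQs hx2.2).2
    have e : branch α t x = 1 / 2 := by dsimp only at e2; linarith
    rw [mem_singleton_iff, ← e, branchInv_branch hα ht ht1 ⟨hp.le.trans hx1.1.1, hx1.1.2⟩]
  · exact (measurableSet_Icc.inter
      ((continuous_const.sub (continuous_branch hα)).measurable hQ)).nullMeasurableSet

/-- Points of `[p, 1/2]` whose folded orbit stays in `[p, 1/2]` up to time `n`. -/
def survivors (α p : ℝ) (ω : ℕ → ℝ) (n : ℕ) : Set ℝ :=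
  {x | ∀ j ≤ n, foldIter α ω j x ∈ Icc p (1 / 2)}

variable {ω : ℕ → ℝ}

lemma isConeDensity_survivalDensity (hα : 0 < α) (hα1 : α < 1) (hp : 0 < p) (hp2 : p < 1 / 2)
    (hω : ∀ i, 0 < ω i) (hω1 : ∀ i, ω i < 1) (hfix : ∀ i, branch α (ω i) p ≤ p) (n : ℕ) :
    IsConeDensity p (survivalDensity α ω n) := by
  induction n with
  | zero => exact ⟨fun _ _ => zero_le_one, antitoneOn_const, convexOn_const _ (convex_Icc _ _)⟩
  | succ n ih => exact ih.transfer hα hα1 (hω n) (hω1 n) hp hp2 (hfix n)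

lemma volume_survivors_inter (hα : 0 < α) (hα1 : α < 1) (hp : 0 < p) (hp2 : p < 1 / 2)
    (hω : ∀ i, 0 < ω i) (hω1 : ∀ i, ω i < 1) (hfix : ∀ i, branch α (ω i) p ≤ p) (n : ℕ)
    {Q : Set ℝ} (hQ : MeasurableSet Q) (hQs : Q ⊆ Icc p (1 / 2)) :
    volume (survivors α p ω n ∩ foldIter α ω n ⁻¹' Q) =
      ∫⁻ y in Q, ENNReal.ofReal (survivalDensity α ω n y) := by
  induction n generalizing Q with
  | zero =>
    simp only [survivalDensity, ENNReal.ofReal_one, setLIntegral_one]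
    congr 1
    ext x
    simp only [survivors, Nat.le_zero, forall_eq, foldIter, id, mem_inter_iff, mem_ofPred_eq]
    exact ⟨fun hx => hx.2, fun hx => ⟨hQs hx, hx⟩⟩
  | succ n ih =>
    rw [survivalDensity, ← lintegral_foldMap_preimage hα hα1 (hω n) (hω1 n) hp hp2 (hfix n)
      (isConeDensity_survivalDensity hα hα1 hp hp2 hω hω1 hfix n) hQ hQs,
      ← ih (measurableSet_Icc.inter ((continuous_foldMap hα).measurable hQ)) inter_subset_left]
    congr 1
    ext x
    constructor
    · rintro ⟨hx, hxQ⟩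
      exact ⟨fun j hj => hx j (hj.trans n.le_succ), hx n n.le_succ, hxQ⟩
    · rintro ⟨hx, -, hxQ⟩
      refine ⟨fun j hj => ?_, hxQ⟩
      rcases Nat.le_succ_iff.1 hj with hj | rfl
      · exact hx j hj
      · exact hQs hxQ

/-- A neighbourhood of `1/2` is sent by the folded map below `p`. -/
lemma foldMap_lt_of_gap (hα : 0 < α) (hα1 : α < 1) (ht : 0 < t) (ht1 : t < 1)
    {x : ℝ} (hx0 : 0 ≤ x) (hx2 : x ≤ 1 / 2) (hx : 1 / 2 - p / 4 < x) :
    foldMap α t x < p := by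
  refine (min_le_right _ _).trans_lt ?_
  have h1 : (2 * x) ^ (1 : ℝ) ≤ (2 * x) ^ α := by
    rcases hx0.eq_or_lt with rfl | h0
    · simp [Real.zero_rpow hα.ne']
    · exact Real.rpow_le_rpow_of_exponent_ge (by linarith) (by linarith) hα1.le
  rw [Real.rpow_one] at h1
  rw [branch_eq hα hx0]
  have h2 : (2 - t) * (2 * x) ≤ (2 - t) * (2 * x) ^ α :=
    mul_le_mul_of_nonneg_left h1 (by linarith)
  have h3 : x * (t + (2 - t) * (2 * x)) ≤ x * (t + (2 - t) * (2 * x) ^ α) :=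
    mul_le_mul_of_nonneg_left (by linarith) hx0
  have h4 : 0 ≤ t * (x * (1 - 2 * x)) := mul_nonneg ht.le (mul_nonneg hx0 (by linarith))
  nlinarith [sq_nonneg (1 - 2 * x)]

end Measure

section Escape

variable {α p lam : ℝ} {ω : ℕ → ℝ}

lemma continuous_foldIter (hα : 0 < α) (n : ℕ) : Continuous (foldIter α ω n) := by
  induction n with
  | zero => exact continuous_id
  | succ n ih => exact (continuous_foldMap hα).comp ih

lemma measurableSet_survivors (hα : 0 < α) (n : ℕ) : MeasurableSet (survivors α p ω n) := by
  have : survivors α p ω n = ⋂ j, ⋂ (_ : j ≤ n), foldIter α ω j ⁻¹' Icc p (1 / 2) := by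
    ext x
    simp [survivors]
  rw [this]
  exact .iInter fun j => .iInter fun _ => (continuous_foldIter hα j).measurable measurableSet_Icc

lemma tendsto_zero_of_dissipation {a b m : ℕ → ℝ} {ε κ : ℝ} (hε : 0 < ε) (hκ : κ < 1)
    (hb : ∀ n, 0 ≤ b n) (hm : ∀ n, 0 ≤ m n) (hdiss : ∀ n, m (n + 1) + ε * a n ≤ m n)
    (hstep : ∀ n, b (n + 1) ≤ b n * κ + a (n + 1)) : Tendsto b atTop (𝓝 0) := by
  have key : ∀ N, ε * (1 - κ) * ∑ k ∈ Finset.range N, b k + ε * b N + m (N + 1) ≤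
      ε * b 0 + m 1 := by
    intro N
    induction N with
    | zero => simp
    | succ N ih =>
      rw [Finset.sum_range_succ]
      have h1 := hdiss (N + 1)
      have h2 := mul_le_mul_of_nonneg_left (hstep N) hε.le
      linarith
  have hc : 0 < ε * (1 - κ) := mul_pos hε (by linarith)
  refine (summable_of_sum_range_le (c := (ε * b 0 + m 1) / (ε * (1 - κ))) hb fun N => ?_)
    |>.tendsto_atTop_zero
  rw [le_div_iff₀ hc]
  have h1 := key N
  have h2 := mul_nonneg hε.le (hb N)
  have h3 := hm (N + 1)
  linarith

lemma volume_iInter_survivors (hα : 0 < α) (hα1 : α < 1) (hp : 0 < p) (hp2 : p < 1 / 2)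
    (hω : ∀ i, 0 < ω i) (hω1 : ∀ i, ω i < 1) (hfix : ∀ i, branch α (ω i) p ≤ p)
    (hlam : 1 < lam) (hexp : ∀ i, lam ≤ branchDeriv α (ω i) p) :
    volume (⋂ n, survivors α p ω n) = 0 := by
  have hc := isConeDensity_survivalDensity hα hα1 hp hp2 hω hω1 hfix
  have hvol := fun n {Q : Set ℝ} => volume_survivors_inter (Q := Q) hα hα1 hp hp2 hω hω1 hfix n
  have hpm : p ∈ Icc p (1 / 2) := ⟨le_rfl, hp2.le⟩
  have hhm : (1 / 2 : ℝ) ∈ Icc p (1 / 2) := ⟨hp2.le, le_rfl⟩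
  have hsub : ∀ n, survivors α p ω n ⊆ Icc p (1 / 2) := fun n x hx => hx 0 n.zero_le
  have hfin : ∀ n, volume (survivors α p ω n) ≠ ⊤ := fun n =>
    measure_ne_top_of_subset (hsub n) (by simp)
  have hle : ∀ n, volume.real (survivors α p ω n) ≤ survivalDensity α ω n p := by
    intro n
    have h1 := hvol n measurableSet_Icc subset_rfl
    have h2 : survivors α p ω n ⊆ foldIter α ω n ⁻¹' Icc p (1 / 2) := fun x hx => hx n le_rfl
    rw [inter_eq_self_of_subset_left h2] at h1
    refine ENNReal.toReal_le_of_le_ofReal ((hc n).nonneg _ hpm) ?_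
    rw [h1]
    calc ∫⁻ y in Icc p (1 / 2), ENNReal.ofReal (survivalDensity α ω n y)
        ≤ ∫⁻ _ in Icc p (1 / 2), ENNReal.ofReal (survivalDensity α ω n p) :=
          setLIntegral_mono measurable_const fun y hy =>
            ENNReal.ofReal_le_ofReal ((hc n).antitone hpm hy hy.1)
      _ ≤ ENNReal.ofReal (survivalDensity α ω n p) := by
          rw [setLIntegral_const, Real.volume_Icc]
          refine mul_le_of_le_one_right' ?_
          exact ENNReal.ofReal_le_one.2 (by linarith)
  set ε := p / 4 * (1 / 2 - p) with hεdef
  have hε : 0 < ε := mul_pos (by linarith) (by linarith)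
  have hε1 : ε ≤ p / 4 := mul_le_of_le_one_right (by linarith) (by linarith)
  have hε2 : ε ≤ 1 / 2 - p := mul_le_of_le_one_left (by linarith) (by linarith)
  have hgap : Ioc (1 / 2 - ε) (1 / 2) ⊆ Icc p (1 / 2) := fun x hx => ⟨by linarith [hx.1], hx.2⟩
  have hdiss : ∀ n, volume.real (survivors α p ω (n + 1)) + ε * survivalDensity α ω n (1 / 2) ≤
      volume.real (survivors α p ω n) := by
    intro n
    set G := survivors α p ω n ∩ foldIter α ω n ⁻¹' Ioc (1 / 2 - ε) (1 / 2) with hG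
    have hGm : MeasurableSet G := (measurableSet_survivors hα n).inter
      ((continuous_foldIter hα n).measurable measurableSet_Ioc)
    have hGs : G ⊆ survivors α p ω n := inter_subset_left
    have hdisj : Disjoint (survivors α p ω (n + 1)) G := by
      refine Set.disjoint_left.2 fun x hx hxG => ?_
      have h1 := (hx (n + 1) le_rfl).1
      have h2 := hgap hxG.2
      have h3 := foldMap_lt_of_gap (t := ω n) (p := p) hα hα1 (hω n) (hω1 n)
        (hp.le.trans h2.1) h2.2 (by linarith [hxG.2.1])
      exact absurd h1 (not_le.2 h3)
    have hlow : ε * survivalDensity α ω n (1 / 2) ≤ volume.real G := by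
      refine (ENNReal.ofReal_le_iff_le_toReal (measure_ne_top_of_subset hGs (hfin n))).1 ?_
      rw [hG, hvol n measurableSet_Ioc hgap]
      calc ENNReal.ofReal (ε * survivalDensity α ω n (1 / 2))
          = ∫⁻ _ in Ioc (1 / 2 - ε) (1 / 2),
              ENNReal.ofReal (survivalDensity α ω n (1 / 2)) := by
            rw [setLIntegral_const, Real.volume_Ioc, sub_sub_cancel, mul_comm,
              ENNReal.ofReal_mul ((hc n).nonneg _ hhm)]
        _ ≤ _ := setLIntegral_mono' measurableSet_Ioc fun y hy =>
            ENNReal.ofReal_le_ofReal ((hc n).antitone (hgap hy) hhm hy.2)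
    have hanti : survivors α p ω (n + 1) ⊆ survivors α p ω n := fun x hx j hj =>
      hx j (hj.trans n.le_succ)
    calc _ ≤ volume.real (survivors α p ω (n + 1)) + volume.real G := by gcongr
      _ = volume.real (survivors α p ω (n + 1) ∪ G) :=
          (measureReal_union hdisj hGm (hfin _) (measure_ne_top_of_subset hGs (hfin n))).symm
      _ ≤ _ := measureReal_mono (union_subset hanti hGs) (hfin n)
  have hb := tendsto_zero_of_dissipation hε (inv_lt_one_of_one_lt₀ hlam)
    (fun n => (hc n).nonneg p hpm) (fun n => measureReal_nonneg) hdiss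
    (fun n => (hc n).transfer_left_le hα hα1 (hω n) (hω1 n) hp hp2 (hfix n) (by linarith) (hexp n))
  have hzero : volume.real (⋂ n, survivors α p ω n) ≤ 0 :=
    ge_of_tendsto' hb fun n => (measureReal_mono (iInter_subset _ n) (hfin n)).trans (hle n)
  exact (measureReal_eq_zero_iff (measure_ne_top_of_subset (iInter_subset _ 0) (hfin 0))).1
    (le_antisymm hzero measureReal_nonneg)

end Escape

section Attraction

variable {α s t u : ℝ}

lemma pfix_pos (hu : u < 1) : 0 < pfix α u := by
  have h1 : 0 < 1 - u := by linarith
  have h2 : 0 < 2 - u := by linarith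
  unfold pfix
  positivity

lemma two_mul_pfix_rpow (hα : 0 < α) (hu : u < 1) : (2 * pfix α u) ^ α = (1 - u) / (2 - u) := by
  have h1 : 0 < 1 - u := by linarith
  have h2 : 0 < 2 - u := by linarith
  rw [pfix, ← mul_assoc, mul_one_div_cancel two_ne_zero, one_mul, ← Real.rpow_mul (by positivity),
    one_div_mul_cancel hα.ne', Real.rpow_one]

lemma pfix_lt_half (hα : 0 < α) (hu : u < 1) : pfix α u < 1 / 2 := by
  have h1 : 0 < 1 - u := by linarith
  have h2 : 0 < 2 - u := by linarith
  have : ((1 - u) / (2 - u)) ^ (1 / α) < 1 :=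
    Real.rpow_lt_one (by positivity) ((div_lt_one h2).2 (by linarith)) (by positivity)
  unfold pfix
  linarith

lemma branch_le_mul (hα : 0 < α) (htu : t ≤ u) (hu : u < 1) {x r : ℝ} (hx : 0 ≤ x) (hxr : x ≤ r)
    (hr : r ≤ 1 / 2) : branch α t x ≤ (u + (2 - u) * (2 * r) ^ α) * x := by
  rw [branch_eq hα hx, mul_comm]
  refine mul_le_mul_of_nonneg_right ?_ hx
  have h1 : (2 * x) ^ α ≤ (2 * r) ^ α := by gcongr
  have h2 : (2 * r) ^ α ≤ 1 := Real.rpow_le_one (by linarith) (by linarith) hα.le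
  nlinarith

lemma contraction_pfix (hα : 0 < α) (hu : u < 1) :
    u + (2 - u) * (2 * pfix α u) ^ α = 1 := by
  rw [two_mul_pfix_rpow hα hu, mul_div_cancel₀ _ (by linarith)]
  ring

lemma branch_pfix_le (hα : 0 < α) (htu : t ≤ u) (hu : u < 1) :
    branch α t (pfix α u) ≤ pfix α u := by
  have := branch_le_mul hα htu hu (pfix_pos (α := α) hu).le le_rfl (pfix_lt_half hα hu).le
  rwa [contraction_pfix hα hu, one_mul] at this

lemma foldIter_mem_Icc (hα : 0 < α) {ω : ℕ → ℝ} (hω : ∀ i, 0 < ω i) (hω1 : ∀ i, ω i < 1) {x : ℝ}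
    (hx : x ∈ Icc (0 : ℝ) (1 / 2)) (n : ℕ) : foldIter α ω n x ∈ Icc (0 : ℝ) (1 / 2) := by
  induction n with
  | zero => exact hx
  | succ n ih => exact foldMap_mem_Icc hα (hω n) (hω1 n) ih

lemma tendsto_foldIter_zero (hα : 0 < α) (hu : u < 1) {ω : ℕ → ℝ} (hω : ∀ i, 0 < ω i)
    (hωu : ∀ i, ω i ≤ u) {x : ℝ} (hx : x ∈ Icc (0 : ℝ) (1 / 2)) {N : ℕ}
    (hN : foldIter α ω N x < pfix α u) :
    Tendsto (fun n => foldIter α ω n x) atTop (𝓝 0) := by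
  have hu0 : 0 < u := (hω 0).trans_le (hωu 0)
  have hpos := foldIter_mem_Icc hα hω (fun i => (hωu i).trans_lt hu) hx
  set r := foldIter α ω N x with hr
  have hr0 : 0 ≤ r := (hpos N).1
  set κ := u + (2 - u) * (2 * r) ^ α with hκ
  have hκ1 : κ < 1 := by
    have : (2 * r) ^ α < (2 * pfix α u) ^ α := by gcongr
    rw [← contraction_pfix hα hu, hκ]
    have : 0 < 2 - u := by linarith
    gcongr
  have hκ0 : 0 ≤ κ := by
    have : 0 < 2 - u := by linarith
    positivity
  have hbound : ∀ k, foldIter α ω (k + N) x ≤ κ ^ k * r := by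
    intro k
    induction k with
    | zero => simp [hr]
    | succ k ih =>
      have hkr : foldIter α ω (k + N) x ≤ r :=
        ih.trans (mul_le_of_le_one_left hr0 (pow_le_one₀ hκ0 hκ1.le))
      rw [Nat.add_right_comm]
      calc foldMap α (ω (k + N)) (foldIter α ω (k + N) x)
          ≤ branch α (ω (k + N)) (foldIter α ω (k + N) x) := min_le_left _ _
        _ ≤ κ * foldIter α ω (k + N) x :=
            branch_le_mul hα (hωu _) hu (hpos _).1 hkr (hpos N).2
        _ ≤ κ * (κ ^ k * r) := by gcongr
        _ = κ ^ (k + 1) * r := by ring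
  refine (tendsto_add_atTop_iff_nat N).1 ?_
  refine squeeze_zero (fun k => (hpos _).1) hbound ?_
  simpa using (tendsto_pow_atTop_nhds_zero_of_lt_one hκ0 hκ1).mul_const r

lemma Flift_of_lt_half {x : ℝ} (hx0 : 0 ≤ x) (hx : x < 1 / 2) : Flift α t x = branch α t x := by
  have hfl : ⌊x⌋ = 0 := Int.floor_eq_zero_iff.2 ⟨hx0, by linarith⟩
  have hfr : Int.fract x = x := Int.fract_eq_self.2 ⟨hx0, by linarith⟩
  simp [Flift, hfl, hfr, branch, show x < 2⁻¹ by linarith]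

lemma Flift_of_half_le {x : ℝ} (hx : 1 / 2 ≤ x) (hx1 : x < 1) :
    Flift α t x = 2 - branch α t (1 - x) := by
  have hfl : ⌊x⌋ = 0 := Int.floor_eq_zero_iff.2 ⟨by linarith, hx1⟩
  have hfr : Int.fract x = x := Int.fract_eq_self.2 ⟨by linarith, hx1⟩
  simp only [Flift, hfl, hfr, branch, if_neg (not_lt.2 hx)]
  push_cast
  ring

lemma deriv_Flift {x : ℝ} (hα : 0 < α) (hx0 : 0 < x) (hx : x < 1 / 2) :
    deriv (Flift α t) x = branchDeriv α t x := by
  refine ((hasDerivAt_branch hα x).congr_of_eventuallyEq ?_).deriv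
  filter_upwards [Ioo_mem_nhds hx0 hx] with y hy using Flift_of_lt_half hy.1.le hy.2

lemma norm_coe_of_mem_Icc {z : ℝ} (hz : z ∈ Icc (0 : ℝ) 1) : ‖(z : Circle1)‖ = min z (1 - z) := by
  rcases le_total z (1 / 2) with h | h
  · rw [min_eq_left (by linarith), (AddCircle.norm_coe_eq_abs_iff 1 one_ne_zero).2,
      abs_of_nonneg hz.1]
    rw [abs_of_nonneg hz.1]
    simpa using h
  · have hz1 := hz.2
    have habs : |z - 1| = 1 - z := by rw [abs_of_nonpos (by linarith), neg_sub]
    rw [min_eq_right (by linarith), ← sub_add_cancel z 1, AddCircle.coe_add_period,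
      (AddCircle.norm_coe_eq_abs_iff 1 one_ne_zero).2, sub_add_cancel, habs]
    rw [habs, abs_one]
    linarith

lemma exists_expansion_rate (hα : 0 < α) (hs : 0 < s) (hsu : s < u) (hu : u < 1)
    (hexp : ∀ t ∈ Icc s u, ∀ x : ℝ,
      pfix α u ≤ dist ((x : Circle1)) (0 : Circle1) → 1 < deriv (Flift α t) x) :
    ∃ lam > 1, ∀ t ∈ Icc s u, lam ≤ branchDeriv α t (pfix α u) := by
  have hp := pfix_pos (α := α) hu
  have hp2 := pfix_lt_half hα hu
  have hgt : ∀ t ∈ Icc s u, 1 < branchDeriv α t (pfix α u) := by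
    intro t ht
    rw [← deriv_Flift hα hp hp2]
    refine hexp t ht _ ?_
    rw [dist_zero_right, norm_coe_of_mem_Icc ⟨hp.le, by linarith⟩]
    exact le_min le_rfl (by linarith)
  have hcont : Continuous fun t => branchDeriv α t (pfix α u) := by
    unfold branchDeriv
    fun_prop
  obtain ⟨t₀, ht₀, hmin⟩ := isCompact_Icc.exists_isMinOn (nonempty_Icc.2 hsu.le)
    hcont.continuousOn
  exact ⟨_, hgt t₀ ht₀, fun t ht => hmin ht⟩

lemma norm_fmap (hα : 0 < α) (ht : 0 < t) (ht1 : t < 1) (x : Circle1) :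
    ‖fmap α t x‖ = foldMap α t ‖x‖ := by
  obtain ⟨y, hy, rfl⟩ : ∃ y ∈ Ico (0 : ℝ) 1, (y : Circle1) = x := by
    have := (AddCircle.coe_image_Ico_eq (1 : ℝ) 0).ge (mem_univ x)
    simpa using this
  have hf : fmap α t (y : Circle1) = ((Flift α t y : ℝ) : Circle1) :=
    AddCircle.liftIco_coe_apply (by simpa using hy)
  rw [hf, norm_coe_of_mem_Icc ⟨hy.1, hy.2.le⟩]
  rcases lt_or_ge y (1 / 2) with h | h
  · rw [Flift_of_lt_half hy.1 h, min_eq_left (by linarith),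
      norm_coe_of_mem_Icc (branch_mem_Icc hα ht ht1 ⟨hy.1, h.le⟩)]
    rfl
  · rw [Flift_of_half_le h hy.2, min_eq_right (by linarith)]
    have h2 : ((2 - branch α t (1 - y) : ℝ) : Circle1) = -((branch α t (1 - y) : ℝ) : Circle1) := by
      rw [AddCircle.coe_sub, sub_eq_neg_self, AddCircle.coe_eq_zero_iff]
      exact ⟨2, by simp⟩
    rw [h2, norm_neg, norm_coe_of_mem_Icc
      (branch_mem_Icc hα ht ht1 ⟨by linarith [hy.2], by linarith⟩)]
    rfl

lemma norm_fIter (hα : 0 < α) {ω : ℕ → ℝ} (hω : ∀ i, 0 < ω i) (hω1 : ∀ i, ω i < 1) (n : ℕ)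
    (x : Circle1) : ‖fIter α ω n x‖ = foldIter α ω n ‖x‖ := by
  induction n with
  | zero => rfl
  | succ n ih =>
    simp only [fIter, foldIter, Function.comp]
    rw [norm_fmap hα (hω n) (hω1 n), ih]

end Attraction

section AlmostEvery

variable {α s u : ℝ}

lemma ae_real_of_ae_norm {q : ℝ → Prop} (hq : MeasurableSet {r | q r})
    (h : volume {r | r ∈ Icc (0 : ℝ) (1 / 2) ∧ ¬ q r} = 0) :
    ∀ᵐ x ∂(volume : Measure Circle1), q ‖x‖ := by
  have hmp := AddCircle.measurePreserving_mk (1 : ℝ) (-1 / 2)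
  have hm : MeasurableSet {x : Circle1 | q ‖x‖} := measurable_norm hq
  rw [← hmp.map_eq, ae_map_iff hmp.measurable.aemeasurable hm, ae_restrict_iff' measurableSet_Ioc]
  have hneg : volume (Neg.neg ⁻¹' {r | r ∈ Icc (0 : ℝ) (1 / 2) ∧ ¬ q r}) = 0 := by
    exact (Measure.measure_preimage_neg volume _).trans h
  refine measure_mono_null ?_ (measure_union_null h hneg)
  intro y hy
  simp only [mem_compl_iff, mem_ofPred_eq, not_forall] at hy
  obtain ⟨⟨hy1, hy2⟩, hy3⟩ := hy
  have hnorm : ‖(y : Circle1)‖ = |y| := by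
    refine (AddCircle.norm_coe_eq_abs_iff 1 one_ne_zero).2 ?_
    rw [abs_one]
    exact abs_le.2 ⟨by linarith, by linarith⟩
  rw [hnorm] at hy3
  rcases le_total 0 y with h0 | h0
  · left
    rw [abs_of_nonneg h0] at hy3
    exact ⟨⟨h0, by linarith⟩, hy3⟩
  · right
    rw [abs_of_nonpos h0] at hy3
    exact ⟨⟨by linarith, by linarith⟩, hy3⟩

lemma measurable_foldIter (α : ℝ) (n : ℕ) :
    Measurable fun q : (ℕ → ℝ) × ℝ => foldIter α q.1 n q.2 := by
  induction n with
  | zero => exact measurable_snd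
  | succ n ih =>
    have hb : Measurable fun q : (ℕ → ℝ) × ℝ => branch α (q.1 n) (foldIter α q.1 n q.2) := by
      unfold branch
      have : Measurable fun q : (ℕ → ℝ) × ℝ => q.1 n := (measurable_pi_apply n).comp measurable_fst
      fun_prop
    exact hb.min (measurable_const.sub hb)

lemma ae_tendsto_foldIter_norm (hα : 0 < α) (hα1 : α < 1) (hs : 0 < s) (hsu : s < u) (hu : u < 1)
    (hexp : ∀ t ∈ Icc s u, ∀ x : ℝ,
      pfix α u ≤ dist ((x : Circle1)) (0 : Circle1) → 1 < deriv (Flift α t) x)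
    {ω : ℕ → ℝ} (hω : ∀ i, ω i ∈ Icc s u) :
    ∀ᵐ x ∂(volume : Measure Circle1), Tendsto (fun n => foldIter α ω n ‖x‖) atTop (𝓝 0) := by
  obtain ⟨lam, hlam, hexp'⟩ := exists_expansion_rate hα hs hsu hu hexp
  have hω0 : ∀ i, 0 < ω i := fun i => hs.trans_le (hω i).1
  have hω1 : ∀ i, ω i < 1 := fun i => (hω i).2.trans_lt hu
  refine ae_real_of_ae_norm (q := fun r => Tendsto (fun n => foldIter α ω n r) atTop (𝓝 0))
    (measurableSet_tendsto _ fun n => (continuous_foldIter hα n).measurable) ?_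
  refine measure_mono_null ?_ (volume_iInter_survivors hα hα1 (pfix_pos hu) (pfix_lt_half hα hu)
    hω0 hω1 (fun i => branch_pfix_le hα (hω i).2 hu) hlam fun i => hexp' _ (hω i))
  rintro r ⟨hr, hnt⟩
  refine mem_iInter.2 fun n j _ => ⟨?_, (foldIter_mem_Icc hα hω0 hω1 hr j).2⟩
  by_contra! hlt
  exact hnt (tendsto_foldIter_zero hα hu hω0 (fun i => (hω i).2) hr hlt)

lemma IsProductOf.ae_forall_mem {Y : Type*} [MeasurableSpace Y] {θ : Measure Y}
    {P : Measure (ℕ → Y)} (hP : IsProductOf θ P) {A : Set Y} (hA : MeasurableSet A)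
    (hθ : θ A = 1) : ∀ᵐ ω ∂P, ∀ i, ω i ∈ A := by
  have := hP.1
  refine ae_all_iff.2 fun i => ?_
  have h1 : P {ω | ∀ j < i + 1, ω j ∈ A} = 1 := by
    rw [hP.2 (i + 1) (fun _ => A) fun _ => hA]
    simp [hθ]
  have hm : MeasurableSet {ω : ℕ → Y | ∀ j < i + 1, ω j ∈ A} := by
    have : {ω : ℕ → Y | ∀ j < i + 1, ω j ∈ A} = ⋂ j, ⋂ (_ : j < i + 1), (fun ω => ω j) ⁻¹' A := by
      ext ω
      simp
    rw [this]
    exact .iInter fun j => .iInter fun _ => measurable_pi_apply j hA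
  filter_upwards [(prob_compl_eq_zero_iff hm).2 h1] with ω hω using hω i i.lt_succ_self

end AlmostEvery

/-- if `f_t' > 1` on `{dist(·,0) ≥ p_u}` for all `t ∈ [s,u]`, then for
every probability `θ` on `[s,u]`, for `θ^ℕ × m`-almost every `(ω,x)` the empirical
measures of the random orbit of `x` converge to `δ₀` in the weak* topology. -/
theorem empirical_measures_tendsto_dirac
    (α : ℝ) (hα0 : 0 < α) (hα1 : α < 1)
    (s u : ℝ) (hs : 0 < s) (hsu : s < u) (hu : u < 1)
    (hexp : ∀ t ∈ Icc s u, ∀ x : ℝ,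
      pfix α u ≤ dist ((x : Circle1)) (0 : Circle1) → 1 < deriv (Flift α t) x)
    (θ : Measure ℝ) (hθprob : IsProbabilityMeasure θ) (hθsupp : θ (Icc s u)ᶜ = 0)
    (P : Measure (ℕ → ℝ)) (hP : IsProductOf θ P) :
    ∀ᵐ p ∂(P.prod (volume : Measure Circle1)),
      ∀ φ : C(Circle1, ℝ),
        Tendsto (fun N : ℕ => (N : ℝ)⁻¹ * ∑ j ∈ Finset.range N, φ (fIter α p.1 j p.2))
          atTop (𝓝 (φ 0)) := by
  have hPprob := hP.1
  have hθI : θ (Icc s u) = 1 := (prob_compl_eq_zero_iff measurableSet_Icc).1 hθsupp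
  have hω := hP.ae_forall_mem measurableSet_Icc hθI
  have hmeas : MeasurableSet {q : (ℕ → ℝ) × Circle1 |
      Tendsto (fun n => foldIter α q.1 n ‖q.2‖) atTop (𝓝 0)} :=
    measurableSet_tendsto _ fun n =>
      (measurable_foldIter α n).comp (measurable_fst.prodMk (measurable_norm.comp measurable_snd))
  have hconv : ∀ᵐ q ∂(P.prod (volume : Measure Circle1)),
      Tendsto (fun n => foldIter α q.1 n ‖q.2‖) atTop (𝓝 0) := by
    rw [Measure.ae_prod_iff_ae_ae hmeas]
    filter_upwards [hω] with ω h using ae_tendsto_foldIter_norm hα0 hα1 hs hsu hu hexp h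
  filter_upwards [hconv, Measure.quasiMeasurePreserving_fst.ae hω] with q hq hqω φ
  have h0 : Tendsto (fun n => fIter α q.1 n q.2) atTop (𝓝 0) := by
    rw [tendsto_zero_iff_norm_tendsto_zero]
    refine hq.congr fun n => (norm_fIter hα0 (fun i => hs.trans_le (hqω i).1)
      (fun i => (hqω i).2.trans_lt hu) n q.2).symm
  exact ((φ.continuous.tendsto 0).comp h0).cesaro
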